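/- arXiv:2212.03571 — 5 statements merged into one kernel-verified Lean document; each statement's English description precedes it below -/
import Mathlib

section
/- Let (G_n)_{n≥2} be a sequence of graphs where G_n is a connected simple graph on n vertices, and suppose that n·μ(G_n) → 0 as n → ∞. For each n let x_n be a unit Fiedler vector of G_n (a unit eigenvector of L(G_n) with eigenvalue μ(G_n)). Then max_{v ∈ V(G_n)} |x_n(v)| → 0 as n → ∞. -/
open Matrix Finset Filter

/-- The Laplacian quadratic form `xᵀ L(G) x`. -/
noncomputable def lapQ {V : Type*} [Fintype V] (G : SimpleGraph V) (x : V → ℝ) : ℝ :=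
  letI := Classical.decEq V
  letI : DecidableRel G.Adj := Classical.decRel _
  x ⬝ᵥ (G.lapMatrix ℝ *ᵥ x)

/-- The Laplacian matrix of `G` over `ℝ` (classical decidability). -/
noncomputable def lapMat {V : Type*} [Fintype V] (G : SimpleGraph V) : Matrix V V ℝ :=
  letI := Classical.decEq V
  letI : DecidableRel G.Adj := Classical.decRel _
  G.lapMatrix ℝ

/-- The algebraic connectivity `μ(G)`: the infimum of Rayleigh quotients of the Laplacian
over nonzero vectors orthogonal to the all-ones vector. -/
noncomputable def algConn {V : Type*} [Fintype V] (G : SimpleGraph V) : ℝ :=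
  sInf {r : ℝ | ∃ x : V → ℝ, x ≠ 0 ∧ (∑ v, x v) = 0 ∧ r = lapQ G x / (∑ v, (x v) ^ 2)}

/-- The squared difference of the values of `x` at two vertices of a connected graph is at most the
number of vertices times the total energy over ordered adjacent pairs. -/
theorem SimpleGraph.Connected.sub_sq_le_card_mul_energy {V : Type*} [Fintype V]
    {G : SimpleGraph V} [DecidableRel G.Adj] (hG : G.Connected) (x : V → ℝ) (v w : V) :
    (x v - x w) ^ 2 ≤
      Fintype.card V * ∑ i, ∑ j, if G.Adj i j then (x i - x j) ^ 2 else 0 := by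
  classical
  obtain ⟨p, hp⟩ := (hG.preconnected w v).exists_isPath
  have hnn : ∀ i j, 0 ≤ (if G.Adj i j then (x i - x j) ^ 2 else 0) := by
    intro i j
    split_ifs <;> positivity
  have htel : ∑ i ∈ range p.length, (x (p.getVert (i + 1)) - x (p.getVert i)) = x v - x w := by
    rw [Finset.sum_range_sub (fun i => x (p.getVert i))]
    simp
  have hinj : Set.InjOn p.getVert (range p.length : Set ℕ) :=
    hp.getVert_injOn.mono fun i hi => by
      have : i < p.length := by simpa using hi
      exact this.le
  have hsum : ∑ i ∈ range p.length, (x (p.getVert (i + 1)) - x (p.getVert i)) ^ 2 ≤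
      ∑ i, ∑ j, if G.Adj i j then (x i - x j) ^ 2 else 0 := by
    calc
      _ ≤ ∑ i ∈ range p.length, ∑ j,
            if G.Adj (p.getVert i) j then (x (p.getVert i) - x j) ^ 2 else 0 := by
          refine Finset.sum_le_sum fun i hi => ?_
          have hadj := p.adj_getVert_succ (Finset.mem_range.mp hi)
          refine le_trans (le_of_eq ?_) (Finset.single_le_sum (fun j _ => hnn (p.getVert i) j)
            (Finset.mem_univ (p.getVert (i + 1))))
          rw [if_pos hadj]
          ring
      _ = ∑ i ∈ (range p.length).image p.getVert, ∑ j,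
            if G.Adj i j then (x i - x j) ^ 2 else 0 := by
          rw [Finset.sum_image hinj]
      _ ≤ _ := Finset.sum_le_sum_of_subset_of_nonneg (Finset.subset_univ _)
          fun i _ _ => Finset.sum_nonneg fun j _ => hnn i j
  calc
    (x v - x w) ^ 2
        = (∑ i ∈ range p.length, (x (p.getVert (i + 1)) - x (p.getVert i))) ^ 2 := by rw [htel]
    _ ≤ p.length * ∑ i ∈ range p.length, (x (p.getVert (i + 1)) - x (p.getVert i)) ^ 2 := by
        simpa using sq_sum_le_card_mul_sum_sq (s := range p.length)
          (f := fun i => x (p.getVert (i + 1)) - x (p.getVert i))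
    _ ≤ _ := mul_le_mul (by exact_mod_cast hp.length_lt.le) hsum
        (Finset.sum_nonneg fun _ _ => sq_nonneg _) (Nat.cast_nonneg _)

/-- A unit eigenvector of the Laplacian of a connected graph with eigenvalue `c` has all entries
bounded in terms of `c` and the number of vertices. -/
theorem abs_le_of_lapMat_mulVec_eq {V : Type*} [Fintype V] {G : SimpleGraph V}
    (hG : G.Connected) {x : V → ℝ} {c : ℝ} (hunit : ∑ v, x v ^ 2 = 1)
    (heig : lapMat G *ᵥ x = c • x) (v : V) :
    |x v| ≤ √(1 / (Fintype.card V : ℝ)) + √(2 * (Fintype.card V * c)) := by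
  classical
  have henergy : ∑ i, ∑ j, (if G.Adj i j then (x i - x j) ^ 2 else 0) = 2 * c := by
    have h := G.lapMatrix_toLinearMap₂' ℝ x
    have heig' : G.lapMatrix ℝ *ᵥ x = c • x := by
      rw [← heig, lapMat]
    have hdot : x ⬝ᵥ x = 1 := by
      simpa [dotProduct, sq] using hunit
    rw [Matrix.toLinearMap₂'_apply', heig', dotProduct_smul, hdot, smul_eq_mul, mul_one] at h
    linarith
  have : Nonempty V := ⟨v⟩
  have hcard : (0 : ℝ) < Fintype.card V := by exact_mod_cast Fintype.card_pos
  obtain ⟨w, -, hw⟩ : ∃ w ∈ (univ : Finset V), x w ^ 2 ≤ 1 / (Fintype.card V : ℝ) := by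
    refine Finset.exists_le_of_sum_le univ_nonempty ?_
    rw [hunit, Finset.sum_const, Finset.card_univ, nsmul_eq_mul, mul_one_div_cancel hcard.ne']
  have hdiff : |x v - x w| ≤ √(2 * (Fintype.card V * c)) := by
    apply Real.abs_le_sqrt
    have h := hG.sub_sq_le_card_mul_energy x v w
    rw [henergy] at h
    linarith
  have hw' := Real.abs_le_sqrt hw
  have htri := abs_add_le (x w) (x v - x w)
  rw [add_sub_cancel] at htri
  linarith

/-- If `G_n` is a connected graph on `n` vertices (`n ≥ 2`), `n·μ(G_n) → 0`,
and `x_n` is a unit Fiedler vector of `G_n`, then `max_v |x_n(v)| → 0`. -/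
theorem statement2 (G : (n : ℕ) → SimpleGraph (Fin (n + 2)))
    (hconn : ∀ n, (G n).Connected)
    (x : (n : ℕ) → Fin (n + 2) → ℝ)
    (hunit : ∀ n, ∑ v, (x n v) ^ 2 = 1)
    (heig : ∀ n, lapMat (G n) *ᵥ x n = algConn (G n) • x n)
    (hmu : Tendsto (fun n => ((n + 2 : ℕ) : ℝ) * algConn (G n)) atTop (nhds 0)) :
    Tendsto (fun n => ⨆ v : Fin (n + 2), |x n v|) atTop (nhds 0) := by
  have h0 : Tendsto (fun n : ℕ => 1 / ((n + 2 : ℕ) : ℝ)) atTop (nhds 0) :=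
    tendsto_one_div_atTop_nhds_zero_nat.comp (tendsto_add_atTop_nat 2)
  have hlim : Tendsto (fun n : ℕ => √(1 / ((n + 2 : ℕ) : ℝ)) +
      √(2 * (((n + 2 : ℕ) : ℝ) * algConn (G n)))) atTop (nhds 0) := by
    simpa using h0.sqrt.add (hmu.const_mul 2).sqrt
  refine squeeze_zero (fun n => Real.iSup_nonneg fun v => abs_nonneg _) (fun n => ?_) hlim
  refine ciSup_le fun v => ?_
  simpa only [Fintype.card_fin] using abs_le_of_lapMat_mulVec_eq (hconn n) (hunit n) (heig n) v
end

section
/- Let G be a finite simple graph on n vertices, let x be a unit vector with L(G)x = μx for some real μ, and let r, s be vertices of G lying in the same connected component at graph distance t. Then (x(r) − x(s))² ≤ t² · n · μ². -/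
open Matrix Finset Filter

/-- Each entry of `L(G)x` is the sum of the differences of `x` along the incident edges. -/
theorem lapMat_mulVec_eq_sum {V : Type*} [Fintype V] (G : SimpleGraph V) (x : V → ℝ) (i : V) :
    (lapMat G *ᵥ x) i = ∑ j, (open Classical in if G.Adj i j then x i - x j else 0) := by
  classical
  have hL : lapMat G = G.lapMatrix ℝ := by
    unfold lapMat
    congr!
  rw [hL, SimpleGraph.lapMatrix_mulVec_apply, ← Finset.sum_filter, Finset.sum_sub_distrib,
    Finset.sum_const, nsmul_eq_mul, ← SimpleGraph.card_neighborFinset_eq_degree,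
    SimpleGraph.neighborFinset_eq_filter]

/-- An antisymmetric function sums to zero over a square. -/
theorem sum_sum_eq_zero_of_antisymm {V : Type*} (S : Finset V) (f : V → V → ℝ)
    (hf : ∀ i j, f i j = -f j i) : ∑ i ∈ S, ∑ j ∈ S, f i j = 0 := by
  have h : ∑ i ∈ S, ∑ j ∈ S, f i j = -∑ i ∈ S, ∑ j ∈ S, f i j := by
    conv_lhs => rw [Finset.sum_comm]
    simp only [← Finset.sum_neg_distrib]
    exact Finset.sum_congr rfl fun i _ => Finset.sum_congr rfl fun j _ => hf j i
  linarith

/-- The drop of `x` along an edge is at most the sum of `L(G)x` over the superlevel set of `x`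
at the upper end of the edge. -/
theorem sub_le_sum_lapMat_mulVec {V : Type*} [Fintype V] (G : SimpleGraph V) (x : V → ℝ)
    {u v : V} (hadj : G.Adj u v) (hlt : x v < x u) :
    x u - x v ≤ ∑ i with x u ≤ x i, (lapMat G *ᵥ x) i := by
  classical
  set S : Finset V := {i | x u ≤ x i} with hS
  set f : V → V → ℝ := fun i j => if G.Adj i j then x i - x j else 0 with hf
  have hanti : ∀ i j, f i j = -f j i := by
    intro i j
    simp only [hf, G.adj_comm j i]
    split_ifs <;> ring
  have hsum : ∑ i ∈ S, (lapMat G *ᵥ x) i = ∑ i ∈ S, ∑ j ∈ Sᶜ, f i j := by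
    have h : ∀ i, (lapMat G *ᵥ x) i = ∑ j ∈ S, f i j + ∑ j ∈ Sᶜ, f i j := by
      intro i
      rw [Finset.sum_add_sum_compl, lapMat_mulVec_eq_sum]
    rw [Finset.sum_congr rfl fun i _ => h i, Finset.sum_add_distrib,
      sum_sum_eq_zero_of_antisymm S f hanti, zero_add]
  have hnonneg : ∀ i ∈ S, ∀ j ∈ Sᶜ, 0 ≤ f i j := by
    intro i hi j hj
    simp only [hS, Finset.mem_compl, Finset.mem_filter, Finset.mem_univ, true_and, not_le] at hi hj
    simp only [hf]
    split_ifs <;> linarith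
  have hu : u ∈ S := by simp [hS]
  have hv : v ∈ Sᶜ := by simpa [hS] using hlt
  rw [hsum]
  calc x u - x v = f u v := by simp [hf, hadj]
    _ ≤ ∑ j ∈ Sᶜ, f u j := Finset.single_le_sum (hnonneg u hu) hv
    _ ≤ ∑ i ∈ S, ∑ j ∈ Sᶜ, f i j :=
      Finset.single_le_sum (f := fun i => ∑ j ∈ Sᶜ, f i j)
        (fun i hi => Finset.sum_nonneg (hnonneg i hi)) hu

/-- A unit vector has partial sums at most the square root of the dimension. -/
theorem abs_sum_le_sqrt_card {V : Type*} [Fintype V] (x : V → ℝ)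
    (hunit : ∑ v, (x v) ^ 2 = 1) (S : Finset V) : |∑ i ∈ S, x i| ≤ √(Fintype.card V) := by
  apply Real.abs_le_sqrt
  have hle : ∑ i ∈ S, x i ^ 2 ≤ 1 := hunit ▸
    Finset.sum_le_sum_of_subset_of_nonneg (Finset.subset_univ S) fun i _ _ => sq_nonneg (x i)
  have hcard : (S.card : ℝ) ≤ Fintype.card V := by exact_mod_cast Finset.card_le_univ S
  calc (∑ i ∈ S, x i) ^ 2 ≤ S.card * ∑ i ∈ S, x i ^ 2 := sq_sum_le_card_mul_sum_sq
    _ ≤ S.card * 1 := by gcongr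
    _ ≤ Fintype.card V := by rwa [mul_one]

/-- The entries of a unit Laplacian eigenvector differ by at most `|μ| √n` along an edge. -/
theorem abs_sub_le_of_adj {V : Type*} [Fintype V] (G : SimpleGraph V) (x : V → ℝ) (μ : ℝ)
    (hunit : ∑ v, (x v) ^ 2 = 1) (heig : lapMat G *ᵥ x = μ • x) {u v : V} (hadj : G.Adj u v) :
    |x u - x v| ≤ |μ| * √(Fintype.card V) := by
  wlog hlt : x v < x u generalizing u v
  · rcases (not_lt.mp hlt).eq_or_lt with h | h
    · rw [h, sub_self, abs_zero]
      positivity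
    · rw [abs_sub_comm]
      exact this hadj.symm h
  rw [abs_of_pos (sub_pos.mpr hlt)]
  refine (sub_le_sum_lapMat_mulVec G x hadj hlt).trans ?_
  simp only [heig, Pi.smul_apply, smul_eq_mul, ← Finset.mul_sum]
  refine (le_abs_self _).trans ?_
  rw [abs_mul]
  exact mul_le_mul_of_nonneg_left (abs_sum_le_sqrt_card x hunit _) (abs_nonneg μ)

/-- A function that changes by at most `c` along each edge changes by at most `c` times the
length along a walk. -/
theorem abs_sub_le_length_mul {V : Type*} {G : SimpleGraph V} {x : V → ℝ} {c : ℝ}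
    (hc : ∀ u v, G.Adj u v → |x u - x v| ≤ c) {r s : V} (p : G.Walk r s) :
    |x r - x s| ≤ p.length * c := by
  induction p with
  | nil => simp
  | @cons u v w hadj p ih =>
    rw [SimpleGraph.Walk.length_cons]
    push_cast
    linarith [abs_sub_le (x u) (x v) (x w), hc u v hadj]

/-- If `x` is a unit vector with `L(G)x = μx` and `r, s` are vertices in the
same connected component at distance `t`, then `(x(r) − x(s))² ≤ t² · n · μ²`. -/
theorem statement3 {V : Type*} [Fintype V] (G : SimpleGraph V) (x : V → ℝ) (μ : ℝ)
    (hunit : ∑ v, (x v) ^ 2 = 1) (heig : lapMat G *ᵥ x = μ • x)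
    (r s : V) (h : G.Reachable r s) :
    (x r - x s) ^ 2 ≤ (G.dist r s : ℝ) ^ 2 * (Fintype.card V : ℝ) * μ ^ 2 := by
  obtain ⟨p, hp⟩ := h.exists_walk_length_eq_dist
  have hle := abs_sub_le_length_mul (fun u v => abs_sub_le_of_adj G x μ hunit heig) p
  rw [hp] at hle
  calc (x r - x s) ^ 2 = |x r - x s| ^ 2 := (sq_abs _).symm
    _ ≤ (G.dist r s * (|μ| * √(Fintype.card V))) ^ 2 := by gcongr
    _ = (G.dist r s : ℝ) ^ 2 * (Fintype.card V : ℝ) * μ ^ 2 := by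
      rw [mul_pow, mul_pow, sq_abs, Real.sq_sqrt (Nat.cast_nonneg _)]
      ring
end

section
/- Fix natural numbers k and D. For each n ≥ 2, let Γ_n be a connected simple graph whose vertex set is the disjoint union of sets A_n and B_n, where |A_n| = n and |B_n| ≤ k; let G_n be the induced subgraph of Γ_n on A_n and assume G_n is connected; let S_n ⊆ A_n be the set of vertices of A_n that have a neighbor in B_n (in Γ_n), and assume |S_n| ≤ k and that any two vertices of S_n are at distance at most D in G_n. If n·μ(G_n) → 0 as n → ∞, then μ(Γ_n)/μ(G_n) → 1 as n → ∞. -/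
open Matrix Finset Filter

theorem abs_sub_le_of_walk {V : Type*} (G : SimpleGraph V) {x : V → ℝ} {δ : ℝ}
    (h : ∀ u v, G.Adj u v → x u - x v ≤ δ) {u v : V}
    (p : G.Walk u v) : |x u - x v| ≤ p.length * δ := by
  induction p with
  | nil => simp
  | @cons u w v hadj p ih =>
    have h1 := h _ _ hadj
    have h2 := h _ _ hadj.symm
    rw [abs_le] at ih ⊢
    rw [SimpleGraph.Walk.length_cons]
    push_cast
    constructor <;> linarith

open Classical in
theorem two_mul_sq_sub_le_of_isPath {V : Type*} (G : SimpleGraph V) (x : V → ℝ) {u v : V}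
    (p : G.Walk u v) (hp : p.IsPath) :
    2 * (x u - x v) ^ 2 ≤ p.length * ∑ i ∈ p.support.toFinset, ∑ j ∈ p.support.toFinset,
      if G.Adj i j then (x i - x j) ^ 2 else 0 := by
  induction p with
  | nil => simp
  | @cons u w v h p ih =>
    rw [SimpleGraph.Walk.cons_isPath_iff] at hp
    have ih := ih hp.1
    have hT : ∀ i j, 0 ≤ (if G.Adj i j then (x i - x j) ^ 2 else 0) := by
      intro i j
      split_ifs <;> positivity
    have hu : u ∉ p.support.toFinset := by simpa using hp.2
    have hw : w ∈ p.support.toFinset := by simp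
    rw [SimpleGraph.Walk.support_cons, List.toFinset_cons, SimpleGraph.Walk.length_cons]
    generalize p.support.toFinset = T at *
    rw [sum_insert hu]
    simp only [sum_insert hu, sum_add_distrib]
    have h1 : (x u - x w) ^ 2 ≤ ∑ j ∈ T, if G.Adj u j then (x u - x j) ^ 2 else 0 := by
      simpa [h] using single_le_sum (f := fun j => if G.Adj u j then (x u - x j) ^ 2 else 0)
        (fun j _ => hT u j) hw
    have h2 : (x u - x w) ^ 2 ≤ ∑ j ∈ T, if G.Adj j u then (x j - x u) ^ 2 else 0 := by
      convert h1 using 3 with j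
      · exact G.adj_comm _ _
      · ring
    have h3 : 0 ≤ ∑ i ∈ T, ∑ j ∈ T, if G.Adj i j then (x i - x j) ^ 2 else 0 :=
      sum_nonneg fun i _ => sum_nonneg fun j _ => hT i j
    generalize (∑ i ∈ T, ∑ j ∈ T, if G.Adj i j then (x i - x j) ^ 2 else 0) = F at *
    generalize (∑ j ∈ T, if G.Adj u j then (x u - x j) ^ 2 else 0) = P at *
    generalize (∑ j ∈ T, if G.Adj j u then (x j - x u) ^ 2 else 0) = P' at *
    simp only [SimpleGraph.irrefl, if_false, zero_add, Nat.cast_add, Nat.cast_one]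
    have hl : (0 : ℝ) ≤ p.length := Nat.cast_nonneg _
    generalize (p.length : ℝ) = l at *
    have key : 2 * (x u - x v) ^ 2 ≤ (l + 1) * (2 * (x u - x w) ^ 2 + F) := by
      rcases hl.eq_or_lt with rfl | hl
      · have : x w - x v = 0 := by nlinarith
        have : x u - x v = x u - x w := by linarith
        rw [this]; linarith
      · have e : x u - x v = (x u - x w) + (x w - x v) := by ring
        rw [e]
        generalize x u - x w = a at *
        generalize x w - x v = c at *
        have : 0 ≤ (l * a - c) ^ 2 := sq_nonneg _
        have h5 : l * (2 * (a + c) ^ 2) ≤ l * ((l + 1) * (2 * a ^ 2 + F)) := by nlinarith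
        exact le_of_mul_le_mul_left h5 hl
    nlinarith

section LapQ

variable {V : Type*} [Fintype V] (G : SimpleGraph V)

open Classical in
theorem lapQ_eq_sum (x : V → ℝ) :
    lapQ G x = (∑ i, ∑ j, if G.Adj i j then (x i - x j) ^ 2 else 0) / 2 := by
  rw [← SimpleGraph.lapMatrix_toLinearMap₂', Matrix.toLinearMap₂'_apply']
  unfold lapQ
  congr!

theorem lapQ_nonneg (x : V → ℝ) : 0 ≤ lapQ G x := by
  rw [lapQ_eq_sum]
  have : ∀ i j, 0 ≤ (x i - x j) ^ 2 := fun i j => sq_nonneg _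
  refine div_nonneg (sum_nonneg fun i _ => sum_nonneg fun j _ => ?_) two_pos.le
  split_ifs <;> simp [this]

theorem lapQ_sub_const (x : V → ℝ) (c : ℝ) : lapQ G (fun v => x v - c) = lapQ G x := by
  simp [lapQ_eq_sum]

open Classical in
theorem lapQ_add_smul (x y : V → ℝ) (t : ℝ) :
    lapQ G (fun v => x v + t * y v) =
      lapQ G x + t * (∑ i, ∑ j, if G.Adj i j then (x i - x j) * (y i - y j) else 0) +
        t ^ 2 * lapQ G y := by
  simp only [lapQ_eq_sum, mul_sum, sum_div, ← sum_add_distrib]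
  refine sum_congr rfl fun i _ => sum_congr rfl fun j _ => ?_
  split_ifs <;> ring

theorem lapQ_smul (x : V → ℝ) (t : ℝ) : lapQ G (fun v => t * x v) = t ^ 2 * lapQ G x := by
  simp only [lapQ_eq_sum, mul_sum, sum_div]
  refine sum_congr rfl fun i _ => sum_congr rfl fun j _ => ?_
  split_ifs <;> ring

theorem continuous_lapQ : Continuous (lapQ G) := by
  have : lapQ G = fun x => _ := funext (lapQ_eq_sum G)
  rw [this]
  refine Continuous.div_const (continuous_finsetSum _ fun i _ => continuous_finsetSum _ fun j _ => ?_) _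
  split_ifs <;> fun_prop

theorem sum_sq_pos {x : V → ℝ} (hx : x ≠ 0) : 0 < ∑ v, (x v) ^ 2 := by
  obtain ⟨v, hv⟩ := Function.ne_iff.mp hx
  exact sum_pos' (fun _ _ => sq_nonneg _) ⟨v, mem_univ _, sq_pos_of_ne_zero hv⟩

theorem bddBelow_rayleigh :
    BddBelow {r : ℝ | ∃ x : V → ℝ, x ≠ 0 ∧ (∑ v, x v) = 0 ∧ r = lapQ G x / (∑ v, (x v) ^ 2)} := by
  refine ⟨0, ?_⟩
  rintro r ⟨x, -, -, rfl⟩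
  exact div_nonneg (lapQ_nonneg G x) (sum_nonneg fun _ _ => sq_nonneg _)

theorem algConn_nonneg : 0 ≤ algConn G := by
  refine Real.sInf_nonneg ?_
  rintro r ⟨x, -, -, rfl⟩
  exact div_nonneg (lapQ_nonneg G x) (sum_nonneg fun _ _ => sq_nonneg _)

theorem algConn_mul_sum_sq_le {x : V → ℝ} (hx : ∑ v, x v = 0) :
    algConn G * ∑ v, (x v) ^ 2 ≤ lapQ G x := by
  by_cases h0 : x = 0
  · simpa [h0] using lapQ_nonneg G 0
  · rw [← le_div_iff₀ (sum_sq_pos h0)]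
    exact csInf_le (bddBelow_rayleigh G) ⟨x, h0, hx, rfl⟩

theorem algConn_mul_variance_le [Nonempty V] (x : V → ℝ) :
    algConn G * (∑ v, (x v) ^ 2 - (∑ v, x v) ^ 2 / Fintype.card V) ≤ lapQ G x := by
  have hc : (Fintype.card V : ℝ) ≠ 0 := by simp
  set c := (∑ v, x v) / Fintype.card V with hcdef
  have h := algConn_mul_sum_sq_le G (x := fun v => x v - c) (by
    simp only [sum_sub_distrib, sum_const, card_univ, nsmul_eq_mul, hcdef]
    field_simp
    ring)
  rw [lapQ_sub_const] at h
  convert h using 2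
  simp only [sub_sq, sum_add_distrib, sum_sub_distrib, sum_const, card_univ, nsmul_eq_mul,
    ← sum_mul, ← mul_sum, hcdef]
  field_simp
  ring

theorem exists_sum_eq_zero_ne_zero [Nontrivial V] : ∃ x : V → ℝ, x ≠ 0 ∧ ∑ v, x v = 0 := by
  classical
  obtain ⟨a, b, hab⟩ := exists_pair_ne V
  refine ⟨Pi.single a 1 - Pi.single b 1, fun h => ?_, by simp⟩
  simpa [hab] using congrFun h a

theorem le_algConn [Nontrivial V] {c : ℝ}
    (h : ∀ x : V → ℝ, ∑ v, x v = 0 → c * ∑ v, (x v) ^ 2 ≤ lapQ G x) : c ≤ algConn G := by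
  obtain ⟨x, hx0, hx⟩ := exists_sum_eq_zero_ne_zero (V := V)
  refine le_csInf ⟨_, x, hx0, hx, rfl⟩ ?_
  rintro r ⟨y, hy0, hy, rfl⟩
  rw [le_div_iff₀ (sum_sq_pos hy0)]
  exact h y hy

theorem sq_sub_le_card_mul_lapQ (hG : G.Connected) (x : V → ℝ) (u v : V) :
    (x u - x v) ^ 2 ≤ Fintype.card V * lapQ G x := by
  classical
  obtain ⟨p, hp⟩ := (hG.preconnected u v).exists_isPath
  have h := two_mul_sq_sub_le_of_isPath G x p hp
  have hT : ∀ i j, 0 ≤ (if G.Adj i j then (x i - x j) ^ 2 else 0) := by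
    intro i j
    split_ifs <;> positivity
  have hE : (∑ i ∈ p.support.toFinset, ∑ j ∈ p.support.toFinset,
      if G.Adj i j then (x i - x j) ^ 2 else 0) ≤ 2 * lapQ G x := by
    rw [lapQ_eq_sum, mul_div_cancel₀ _ (two_ne_zero' ℝ)]
    refine (sum_le_sum fun i _ => sum_le_univ_sum_of_nonneg fun j => hT i j).trans ?_
    convert sum_le_univ_sum_of_nonneg (s := p.support.toFinset)
      fun i => sum_nonneg fun j _ => hT i j
  have hl : (p.length : ℝ) ≤ Fintype.card V := mod_cast hp.length_lt.le
  have := mul_le_mul hl hE (sum_nonneg fun i _ => sum_nonneg fun j _ => hT i j)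
    (Nat.cast_nonneg _)
  linarith

theorem sq_le_card_mul_lapQ (hG : G.Connected) {x : V → ℝ} (hx : ∑ v, x v = 0) (v : V) :
    (x v) ^ 2 ≤ Fintype.card V * lapQ G x := by
  have : ∃ w, x w * x v ≤ 0 := by
    by_contra! h
    have hpos : 0 < ∑ w, x w * x v := sum_pos (fun w _ => h w) ⟨v, mem_univ _⟩
    simp [← sum_mul, hx] at hpos
  obtain ⟨w, hw⟩ := this
  have := sq_sub_le_card_mul_lapQ G hG x v w
  nlinarith [sq_nonneg (x w)]

theorem algConn_pos [Nontrivial V] (hG : G.Connected) : 0 < algConn G := by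
  have hc : (0 : ℝ) < Fintype.card V := mod_cast Fintype.card_pos
  refine lt_of_lt_of_le (b := 1 / (Fintype.card V : ℝ) ^ 2) (by positivity) (le_algConn G ?_)
  intro x hx
  have := sum_le_sum fun v (_ : v ∈ univ) => sq_le_card_mul_lapQ G hG hx v
  simp only [sum_const, card_univ, nsmul_eq_mul] at this
  rw [one_div, inv_mul_le_iff₀ (by positivity)]
  linarith

theorem exists_lapQ_eq_algConn [Nontrivial V] :
    ∃ x : V → ℝ, ∑ v, x v = 0 ∧ ∑ v, (x v) ^ 2 = 1 ∧ lapQ G x = algConn G := by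
  have hcomp : IsCompact {x : V → ℝ | ∑ v, x v = 0 ∧ ∑ v, (x v) ^ 2 = 1} := by
    refine Metric.isCompact_of_isClosed_isBounded ?_ ?_
    · exact (isClosed_eq (by fun_prop) continuous_const).inter
        (isClosed_eq (by fun_prop) continuous_const)
    · refine (Metric.isBounded_closedBall (x := (0 : V → ℝ)) (r := 1)).subset ?_
      rintro x ⟨-, hx⟩
      rw [mem_closedBall_zero_iff, pi_norm_le_iff_of_nonneg zero_le_one]
      intro v
      rw [Real.norm_eq_abs, ← sq_le_one_iff_abs_le_one, ← hx]
      exact single_le_sum (f := fun v => (x v) ^ 2) (fun _ _ => sq_nonneg _) (mem_univ v)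
  have hnorm : ∀ x : V → ℝ, x ≠ 0 → ∑ v, x v = 0 →
      (fun v => (√(∑ v, (x v) ^ 2))⁻¹ * x v) ∈
        {x : V → ℝ | ∑ v, x v = 0 ∧ ∑ v, (x v) ^ 2 = 1} := by
    intro x hx0 hx
    have := sum_sq_pos hx0
    refine ⟨by simp [← mul_sum, hx], ?_⟩
    simp only [mul_pow, ← mul_sum, inv_pow, Real.sq_sqrt this.le]
    exact inv_mul_cancel₀ this.ne'
  obtain ⟨x₀, hx₀, hx₀'⟩ := exists_sum_eq_zero_ne_zero (V := V)
  obtain ⟨x, ⟨hx, hx1⟩, hmin⟩ :=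
    hcomp.exists_isMinOn ⟨_, hnorm x₀ hx₀ hx₀'⟩ (continuous_lapQ G).continuousOn
  refine ⟨x, hx, hx1, le_antisymm (le_algConn G fun y hy => ?_) ?_⟩
  · by_cases hy0 : y = 0
    · simpa [hy0] using lapQ_nonneg G 0
    · have h := isMinOn_iff.mp hmin _ (hnorm y hy0 hy)
      have hpos := sum_sq_pos hy0
      rw [lapQ_smul, inv_pow, Real.sq_sqrt hpos.le, inv_mul_eq_div, le_div_iff₀ hpos] at h
      exact h
  · simpa [hx1] using algConn_mul_sum_sq_le G hx

open Classical in
/-- The weak eigenvector equation for a minimizer of the Rayleigh quotient. -/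
theorem sum_adj_mul_eq_of_lapQ_eq_algConn [Nonempty V] {x : V → ℝ} (hx : ∑ v, x v = 0)
    (hx1 : ∑ v, (x v) ^ 2 = 1) (hmin : lapQ G x = algConn G) (y : V → ℝ) :
    (∑ i, ∑ j, if G.Adj i j then (x i - x j) * (y i - y j) else 0) =
      2 * (algConn G * ∑ v, x v * y v) := by
  set B := ∑ i, ∑ j, if G.Adj i j then (x i - x j) * (y i - y j) else 0
  set c := algConn G * (∑ v, (y v) ^ 2 - (∑ v, y v) ^ 2 / Fintype.card V) with hc
  have key : ∀ t : ℝ, 0 ≤ (lapQ G y - c) * (t * t) +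
      (B - 2 * (algConn G * ∑ v, x v * y v)) * t + 0 := by
    intro t
    have h := algConn_mul_variance_le G (fun v => x v + t * y v)
    rw [lapQ_add_smul, hmin] at h
    have e1 : ∑ v, (x v + t * y v) ^ 2 = 1 + 2 * t * ∑ v, x v * y v + t ^ 2 * ∑ v, (y v) ^ 2 := by
      rw [← hx1, mul_sum, mul_sum, ← sum_add_distrib, ← sum_add_distrib]
      exact sum_congr rfl fun v _ => by ring
    have e2 : ∑ v, (x v + t * y v) = t * ∑ v, y v := by
      rw [sum_add_distrib, hx, mul_sum, zero_add]
    rw [e1, e2] at h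
    rw [hc]
    linear_combination h
  have := discrim_le_zero key
  rw [discrim, mul_zero, sub_zero] at this
  have := pow_eq_zero_iff (two_ne_zero) |>.mp (le_antisymm this (sq_nonneg _))
  linarith

/-- For a minimizer of the Rayleigh quotient, the level-set cut at the lower endpoint of an edge
bounds the variation along that edge. -/
theorem sub_le_of_adj [Nonempty V] {x : V → ℝ} (hx : ∑ v, x v = 0)
    (hx1 : ∑ v, (x v) ^ 2 = 1) (hmin : lapQ G x = algConn G) {u v : V} (h : G.Adj u v) :
    x u - x v ≤ algConn G * √(Fintype.card V) := by
  classical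
  have hμ := algConn_nonneg G
  rcases le_or_gt (x u) (x v) with hle | hlt
  · exact (sub_nonpos.mpr hle).trans (by positivity)
  set y : V → ℝ := fun w => if x v < x w then 1 else 0 with hy
  have hB := sum_adj_mul_eq_of_lapQ_eq_algConn G hx hx1 hmin y
  have hT : ∀ i j, 0 ≤ (if G.Adj i j then (x i - x j) * (y i - y j) else 0) := by
    intro i j
    simp only [hy]
    split_ifs <;> nlinarith
  have huv : u ≠ v := h.ne
  have hlow : 2 * (x u - x v) ≤
      ∑ i, ∑ j, if G.Adj i j then (x i - x j) * (y i - y j) else 0 := by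
    have h1 : ∀ a b, (if G.Adj a b then (x a - x b) * (y a - y b) else 0) ≤
        ∑ j, if G.Adj a j then (x a - x j) * (y a - y j) else 0 := fun a b =>
      single_le_sum (f := fun j => if G.Adj a j then (x a - x j) * (y a - y j) else 0)
        (fun j _ => hT a j) (mem_univ b)
    have h2 := sum_le_univ_sum_of_nonneg (s := {u, v})
      (fun i => sum_nonneg fun j (_ : j ∈ univ) => hT i j)
    rw [sum_pair huv] at h2
    have h3 := h1 u v
    have h4 := h1 v u
    rw [if_pos h] at h3
    rw [if_pos h.symm] at h4
    simp only [hy, hlt, lt_irrefl, if_true, if_false] at h2 h3 h4 ⊢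
    linarith
  have hcs : ∑ w, x w * y w ≤ √(Fintype.card V) := by
    refine Real.le_sqrt_of_sq_le ((sum_mul_sq_le_sq_mul_sq univ x y).trans ?_)
    rw [hx1, one_mul]
    have : ∀ w ∈ univ, (y w) ^ 2 ≤ 1 := fun w _ => by simp only [hy]; split_ifs <;> simp
    simpa using sum_le_sum this
  have := mul_le_mul_of_nonneg_left hcs hμ
  linarith

end LapQ

section Sum

variable {A B : Type*} [Fintype A] [Fintype B] (Γ : SimpleGraph (A ⊕ B))

open Classical in
theorem lapQ_sum_eq (z : A ⊕ B → ℝ) :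
    lapQ Γ z = lapQ (Γ.comap Sum.inl) (z ∘ Sum.inl) + lapQ (Γ.comap Sum.inr) (z ∘ Sum.inr) +
      ∑ a, ∑ b, if Γ.Adj (Sum.inl a) (Sum.inr b) then (z (Sum.inl a) - z (Sum.inr b)) ^ 2 else 0 := by
  have hsymm : (∑ b, ∑ a, if Γ.Adj (Sum.inr b) (Sum.inl a) then
      (z (Sum.inr b) - z (Sum.inl a)) ^ 2 else 0) =
      ∑ a, ∑ b, if Γ.Adj (Sum.inl a) (Sum.inr b) then
        (z (Sum.inl a) - z (Sum.inr b)) ^ 2 else 0 := by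
    rw [sum_comm]
    refine sum_congr rfl fun a _ => sum_congr rfl fun b _ => ?_
    rw [Γ.adj_comm, sub_sq_comm]
  simp only [lapQ_eq_sum, Fintype.sum_sum_type, sum_add_distrib, hsymm, SimpleGraph.comap_adj,
    Function.comp_apply]
  ring

theorem lapQ_comap_inl_le (z : A ⊕ B → ℝ) :
    lapQ (Γ.comap Sum.inl) (z ∘ Sum.inl) ≤ lapQ Γ z := by
  classical
  have h : 0 ≤ ∑ a, ∑ b, if Γ.Adj (Sum.inl a) (Sum.inr b) then
      (z (Sum.inl a) - z (Sum.inr b)) ^ 2 else 0 :=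
    sum_nonneg fun a _ => sum_nonneg fun b _ => by split_ifs <;> positivity
  rw [lapQ_sum_eq]
  linarith [lapQ_nonneg (Γ.comap Sum.inr) (z ∘ Sum.inr)]

theorem algConn_le_mul_algConn_sum [Nontrivial A] {k : ℕ} (hB : Fintype.card B ≤ k)
    (hΓ : Γ.Connected) (hG : (Γ.comap Sum.inl).Connected) :
    algConn (Γ.comap Sum.inl) ≤
      (1 + (1 + k) * k * (1 + k) * (Fintype.card A * algConn (Γ.comap Sum.inl))) * algConn Γ := by
  have hμ := algConn_pos _ hG
  set μ := algConn (Γ.comap Sum.inl)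
  have hkB : (Fintype.card B : ℝ) ≤ k := mod_cast hB
  have hN : (1 : ℝ) ≤ Fintype.card A := mod_cast Fintype.card_pos (α := A)
  set N : ℝ := (Fintype.card A : ℝ)
  have hk : (0 : ℝ) ≤ k := Nat.cast_nonneg k
  have : Nontrivial (A ⊕ B) := Sum.inl_injective.nontrivial
  have hpos : 0 < 1 + (1 + k) * k * (1 + k) * (N * μ) := by positivity
  rw [← div_le_iff₀' hpos]
  refine le_algConn Γ fun z hz => ?_
  rw [div_mul_eq_mul_div, div_le_iff₀ hpos]
  have hQ := lapQ_nonneg Γ z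
  have hvar := (algConn_mul_variance_le (Γ.comap Sum.inl) (z ∘ Sum.inl)).trans
    (lapQ_comap_inl_le Γ z)
  simp only [Function.comp_apply] at hvar
  rw [Fintype.sum_sum_type] at hz ⊢
  have hsum : ∑ a, z (Sum.inl a) = -∑ b, z (Sum.inr b) := by linarith
  have hsq : (∑ b, z (Sum.inr b)) ^ 2 ≤ k * ∑ b, (z (Sum.inr b)) ^ 2 := by
    refine (sq_sum_le_card_mul_sum_sq (s := univ) (f := fun b => z (Sum.inr b))).trans ?_
    exact mul_le_mul_of_nonneg_right hkB (sum_nonneg fun _ _ => sq_nonneg _)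
  have hzB : ∑ b, (z (Sum.inr b)) ^ 2 ≤ k * ((1 + k) * N * lapQ Γ z) := by
    have hz' : ∑ v, z v = 0 := by rw [Fintype.sum_sum_type, hz]
    have h1 : ∀ b ∈ univ, (z (Sum.inr b)) ^ 2 ≤ (1 + k) * N * lapQ Γ z := fun b _ => by
      refine (sq_le_card_mul_lapQ Γ hΓ hz' (Sum.inr b)).trans
        (mul_le_mul_of_nonneg_right ?_ hQ)
      rw [Fintype.card_sum, Nat.cast_add]
      nlinarith
    refine (sum_le_sum h1).trans ?_
    rw [sum_const, card_univ, nsmul_eq_mul]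
    exact mul_le_mul_of_nonneg_right hkB (by positivity)
  have hdiv : (∑ a, z (Sum.inl a)) ^ 2 / N ≤ k * ∑ b, (z (Sum.inr b)) ^ 2 := by
    rw [hsum, neg_sq]
    exact (div_le_self (sq_nonneg _) hN).trans hsq
  have hfin : ∑ a, (z (Sum.inl a)) ^ 2 + ∑ b, (z (Sum.inr b)) ^ 2 -
      (1 + k) * (k * ((1 + k) * N * lapQ Γ z)) ≤
      ∑ a, (z (Sum.inl a)) ^ 2 - (∑ a, z (Sum.inl a)) ^ 2 / N := by
    have := mul_le_mul_of_nonneg_left hzB (by positivity : (0 : ℝ) ≤ 1 + k)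
    linarith
  have := (mul_le_mul_of_nonneg_left hfin hμ.le).trans hvar
  linear_combination this

theorem algConn_sum_le_mul_algConn [Nontrivial A] {k D : ℕ} (hB : Fintype.card B ≤ k)
    (hG : (Γ.comap Sum.inl).Connected) {S : Set A}
    (hS : S = {u | ∃ w : B, Γ.Adj (Sum.inl u) (Sum.inr w)}) (hScard : S.ncard ≤ k)
    (hSdist : ∀ u ∈ S, ∀ v ∈ S, (Γ.comap Sum.inl).dist u v ≤ D) :
    algConn Γ ≤
      (1 + k ^ 2 * D ^ 2 * (Fintype.card A * algConn (Γ.comap Sum.inl))) *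
        algConn (Γ.comap Sum.inl) := by
  classical
  obtain ⟨x, hx, hx1, hmin⟩ := exists_lapQ_eq_algConn (Γ.comap Sum.inl)
  have hμ := algConn_pos _ hG
  obtain ⟨s, hs⟩ : ∃ s, ∀ u ∈ S, (Γ.comap Sum.inl).dist u s ≤ D := by
    rcases S.eq_empty_or_nonempty with h | ⟨s, hs⟩
    · exact ⟨Classical.arbitrary A, by simp [h]⟩
    · exact ⟨s, fun u hu => hSdist u hu s hs⟩
  set μ := algConn (Γ.comap Sum.inl)
  set N : ℝ := (Fintype.card A : ℝ) with hN
  have hN0 : 0 < N := by simp [hN, Fintype.card_pos]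
  have hdiff : ∀ u ∈ S, (x u - x s) ^ 2 ≤ D ^ 2 * μ ^ 2 * N := by
    intro u hu
    obtain ⟨p, hp⟩ := hG.exists_walk_length_eq_dist u s
    have h1 := abs_sub_le_of_walk _ (fun _ _ => sub_le_of_adj _ hx hx1 hmin) p
    have h2 : (p.length : ℝ) ≤ D := mod_cast hp ▸ hs u hu
    have h3 : |x u - x s| ≤ D * (μ * √N) :=
      h1.trans (mul_le_mul_of_nonneg_right h2 (by positivity))
    have h4 := pow_le_pow_left₀ (abs_nonneg _) h3 2
    rw [sq_abs, mul_pow, mul_pow, Real.sq_sqrt hN0.le] at h4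
    linarith
  set y : A ⊕ B → ℝ := Sum.elim (fun a => x a - x s) fun _ => 0 with hy
  have hvar := algConn_mul_variance_le Γ y
  have hQ : lapQ Γ y ≤ μ + k ^ 2 * (D ^ 2 * μ ^ 2 * N) := by
    have h0 : lapQ (Γ.comap Sum.inr) (y ∘ Sum.inr) = 0 := by simp [lapQ_eq_sum, hy]
    have h1 : lapQ (Γ.comap Sum.inl) (y ∘ Sum.inl) = μ := by
      rw [← hmin, ← lapQ_sub_const _ x (x s)]
      rfl
    rw [lapQ_sum_eq, h0, h1, add_zero]
    gcongr
    have h2 : ∀ a ∈ univ, (∑ b, if Γ.Adj (Sum.inl a) (Sum.inr b) then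
        (y (Sum.inl a) - y (Sum.inr b)) ^ 2 else 0) ≤
        if a ∈ S then k * (D ^ 2 * μ ^ 2 * N) else 0 := by
      intro a _
      split_ifs with ha
      · have h3 : ∀ b ∈ univ, (if Γ.Adj (Sum.inl a) (Sum.inr b) then
            (y (Sum.inl a) - y (Sum.inr b)) ^ 2 else 0) ≤ D ^ 2 * μ ^ 2 * N := by
          intro b _
          split_ifs
          · simpa [hy] using hdiff a ha
          · positivity
        refine (sum_le_sum h3).trans ?_
        rw [sum_const, card_univ, nsmul_eq_mul]
        gcongr
      · refine (sum_eq_zero fun b _ => if_neg fun hab => ha ?_).le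
        rw [hS]
        exact ⟨b, hab⟩
    refine (sum_le_sum h2).trans ?_
    rw [← sum_filter, sum_const, nsmul_eq_mul]
    have h4 : ((univ.filter (· ∈ S)).card : ℝ) ≤ k := by
      rw [← Set.ncard_coe_finset]
      simpa using hScard
    calc _ ≤ (k : ℝ) * (k * (D ^ 2 * μ ^ 2 * N)) := by gcongr
      _ = _ := by ring
  have hone : 1 ≤ ∑ v, (y v) ^ 2 - (∑ v, y v) ^ 2 / Fintype.card (A ⊕ B) := by
    have e1 : ∑ v, (y v) ^ 2 = 1 + N * x s ^ 2 := by
      simp [hy, Fintype.sum_sum_type, sub_sq, sum_add_distrib, ← sum_mul, ← mul_sum, hx, hx1, hN]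
    have e2 : ∑ v, y v = -(N * x s) := by
      simp [hy, Fintype.sum_sum_type, hx, hN]
    have hc : N ≤ Fintype.card (A ⊕ B) := by simp [hN]
    rw [e1, e2]
    have : (-(N * x s)) ^ 2 / Fintype.card (A ⊕ B) ≤ N * x s ^ 2 := by
      rw [div_le_iff₀ (hN0.trans_le hc)]
      have := mul_le_mul_of_nonneg_left hc (by positivity : 0 ≤ N * x s ^ 2)
      linarith
    linarith
  have := le_mul_of_one_le_right (algConn_nonneg Γ) hone
  linear_combination this + hvar + hQ

end Sum

/-- fix `k` and `D`. For each `n`, `Γ_n` is connected with vertex set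
`A_n ⊔ B_n`, `|A_n| = n`, `|B_n| ≤ k`; `G_n` is the induced (necessarily connected) subgraph
on `A_n`; `S_n ⊆ A_n` is the set of vertices with a neighbor in `B_n`, with `|S_n| ≤ k` and
pairwise `G_n`-distance at most `D`. If `n·μ(G_n) → 0`, then `μ(Γ_n)/μ(G_n) → 1`. -/
theorem statement5 (k D : ℕ) (b : ℕ → ℕ) (hb : ∀ n, b n ≤ k)
    (Γ : (n : ℕ) → SimpleGraph (Fin (n + 2) ⊕ Fin (b n)))
    (hΓconn : ∀ n, (Γ n).Connected)
    (G : (n : ℕ) → SimpleGraph (Fin (n + 2)))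
    (hG : ∀ n, G n = (Γ n).comap Sum.inl)
    (hGconn : ∀ n, (G n).Connected)
    (S : (n : ℕ) → Set (Fin (n + 2)))
    (hS : ∀ n, S n = {u | ∃ w : Fin (b n), (Γ n).Adj (Sum.inl u) (Sum.inr w)})
    (hScard : ∀ n, (S n).ncard ≤ k)
    (hSdist : ∀ n, ∀ u ∈ S n, ∀ v ∈ S n, (G n).dist u v ≤ D)
    (hmu : Tendsto (fun n => ((n + 2 : ℕ) : ℝ) * algConn (G n)) atTop (nhds 0)) :
    Tendsto (fun n => algConn (Γ n) / algConn (G n)) atTop (nhds 1) := by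
  have hpos n : 0 < algConn (G n) := algConn_pos _ (hGconn n)
  have hlow n : 1 / (1 + (1 + k) * k * (1 + k) * (((n + 2 : ℕ) : ℝ) * algConn (G n))) ≤
      algConn (Γ n) / algConn (G n) := by
    have h := algConn_le_mul_algConn_sum (Γ n) (k := k) (by simpa using hb n) (hΓconn n)
      (hG n ▸ hGconn n)
    rw [← hG n, Fintype.card_fin] at h
    have := hpos n
    rw [div_le_div_iff₀ (by positivity) this]
    linarith
  have hupp n : algConn (Γ n) / algConn (G n) ≤
      1 + k ^ 2 * D ^ 2 * (((n + 2 : ℕ) : ℝ) * algConn (G n)) := by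
    have h := algConn_sum_le_mul_algConn (Γ n) (k := k) (D := D) (by simpa using hb n)
      (hG n ▸ hGconn n) (hS n) (hScard n) (hG n ▸ hSdist n)
    rw [← hG n, Fintype.card_fin] at h
    rwa [div_le_iff₀ (hpos n)]
  refine tendsto_of_tendsto_of_tendsto_of_le_of_le ?_ ?_ hlow hupp
  · have h := (hmu.const_mul ((1 + k : ℝ) * k * (1 + k))).const_add 1
    rw [mul_zero, add_zero] at h
    simpa using h.inv₀ one_ne_zero
  · simpa using (hmu.const_mul ((k : ℝ) ^ 2 * D ^ 2)).const_add 1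
end

section
/- Let G be a connected finite simple graph with minimum degree at least d (d ≥ 1), let v be a vertex of G with eccentricity ℓ, and for each i ≥ 0 let P_i = { u ∈ V(G) : dist_G(v,u) = i }. Then for every i with 0 ≤ i ≤ ℓ − 2, |P_i| + |P_{i+1}| + |P_{i+2}| ≥ d + 1. -/
/-- Every distance up to `G.dist v w` is realised by some vertex. -/
theorem SimpleGraph.Connected.exists_dist_eq_of_le {V : Type*} {G : SimpleGraph V}
    (hconn : G.Connected) {v w : V} {k : ℕ} (hk : k ≤ G.dist v w) :
    ∃ u, G.dist v u = k := by
  obtain ⟨p, hp⟩ := hconn.exists_walk_length_eq_dist v w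
  refine ⟨p.getVert k, ?_⟩
  have h₁ := SimpleGraph.dist_le (p.take k)
  have h₂ := SimpleGraph.dist_le (p.drop k)
  have h₃ := hconn.dist_triangle (u := v) (v := p.getVert k) (w := w)
  rw [SimpleGraph.Walk.take_length] at h₁
  rw [SimpleGraph.Walk.drop_length] at h₂
  omega

/-- let `G` be connected with minimum degree at least `d ≥ 1`, let `v` have
eccentricity `ℓ`, and let `P_i = {u : dist(v,u) = i}`. Then for `0 ≤ i ≤ ℓ − 2` we have
`|P_i| + |P_{i+1}| + |P_{i+2}| ≥ d + 1`. -/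
theorem statement13 {V : Type*} [Fintype V] (G : SimpleGraph V) (hconn : G.Connected)
    (d : ℕ) (hd : 1 ≤ d) (hdeg : ∀ u, d ≤ (G.neighborSet u).ncard)
    (v : V) (l : ℕ) (hecc : ∀ u, G.dist v u ≤ l) (hecc' : ∃ u, G.dist v u = l) :
    ∀ i, i + 2 ≤ l →
      d + 1 ≤ ({u | G.dist v u = i} : Set V).ncard
                + ({u | G.dist v u = i + 1} : Set V).ncard
                + ({u | G.dist v u = i + 2} : Set V).ncard := by
  intro i hi
  obtain ⟨w, hw⟩ := hecc'
  obtain ⟨u, hu⟩ := hconn.exists_dist_eq_of_le (v := v) (w := w) (k := i + 1) (by omega)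
  have hsub : insert u (G.neighborSet u) ⊆
      ({x | G.dist v x = i} ∪ {x | G.dist v x = i + 1}) ∪ {x | G.dist v x = i + 2} := by
    rintro x (rfl | hx)
    · exact Or.inl (Or.inr hu)
    · have hux : G.dist u x = 1 := SimpleGraph.dist_eq_one_iff_adj.mpr hx
      have hxu : G.dist x u = 1 := SimpleGraph.dist_comm.trans hux
      have h₁ := hconn.dist_triangle (u := v) (v := u) (w := x)
      have h₂ := hconn.dist_triangle (u := v) (v := x) (w := u)
      simp only [Set.mem_union, Set.mem_ofPred_eq]
      omega
  calc d + 1 ≤ (G.neighborSet u).ncard + 1 := Nat.add_le_add_right (hdeg u) 1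
    _ = (insert u (G.neighborSet u)).ncard :=
      (Set.ncard_insert_of_notMem G.irrefl (Set.toFinite _)).symm
    _ ≤ _ := Set.ncard_le_ncard hsub (Set.toFinite _)
    _ ≤ _ := (Set.ncard_union_le _ _).trans (Nat.add_le_add_right (Set.ncard_union_le _ _) _)
end

section
/- Let G be a connected finite simple graph on n vertices with minimum degree at least d, where d ≥ 1. Then (diam(G) − 1)·(d + 1) ≤ 3n. -/
namespace SimpleGraph

variable {V : Type*} {G : SimpleGraph V}

/-- In a connected graph, every distance up to `G.dist u v` is attained from `u`. -/
lemma Connected.exists_dist_eq_of_le_s14 (hconn : G.Connected) {u v : V} {j : ℕ}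
    (hj : j ≤ G.dist u v) : ∃ w, G.dist u w = j := by
  obtain ⟨p, hp⟩ := hconn.exists_walk_length_eq_dist u v
  refine ⟨p.getVert j, ?_⟩
  have h₁ := dist_le (p.take j)
  have h₂ := dist_le (p.drop j)
  have h₃ := hconn.dist_triangle (u := u) (v := p.getVert j) (w := v)
  rw [Walk.take_length] at h₁
  rw [Walk.drop_length] at h₂
  omega

/-- Distances from `u` to points of a closed neighbourhood of `x` differ by at most one
from `G.dist u x`. -/
lemma Connected.dist_of_mem_insert_neighborSet (hconn : G.Connected) (u : V) {x y : V}
    (hy : y ∈ insert x (G.neighborSet x)) :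
    G.dist u y ≤ G.dist u x + 1 ∧ G.dist u x ≤ G.dist u y + 1 := by
  have h : G.dist x y ≤ 1 := by
    rcases hy with rfl | hy
    · simp
    · exact (dist_eq_one_iff_adj.mpr hy).le
  have h₁ := hconn.dist_triangle (u := u) (v := x) (w := y)
  have h₂ := hconn.dist_triangle (u := u) (v := y) (w := x)
  rw [dist_comm (u := y)] at h₂
  omega

/-- If every vertex has at least `d` neighbours, the disjoint closed neighbourhoods of vertices at
distances `0, 3, 6, …` from `u` together have at most `Fintype.card V` vertices. -/
lemma Connected.mul_succ_le_card [Fintype V] (hconn : G.Connected) {d : ℕ}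
    (hdeg : ∀ u, d ≤ (G.neighborSet u).ncard) (u v : V) :
    (G.dist u v / 3 + 1) * (d + 1) ≤ Fintype.card V := by
  classical
  have hex (i : ℕ) : ∃ w, i ≤ G.dist u v / 3 → G.dist u w = 3 * i := by
    by_cases hi : i ≤ G.dist u v / 3
    · obtain ⟨w, hw⟩ := hconn.exists_dist_eq_of_le_s14 (u := u) (v := v) (j := 3 * i) (by omega)
      exact ⟨w, fun _ ↦ hw⟩
    · exact ⟨u, fun h ↦ absurd h hi⟩
  choose x hx using hex
  let s (i : ℕ) : Finset V := (insert (x i) (G.neighborSet (x i))).toFinset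
  have hs (i : ℕ) : d + 1 ≤ (s i).card := by
    rw [← Set.ncard_eq_toFinset_card', Set.ncard_insert_of_notMem (by simp)]
    exact Nat.succ_le_succ (hdeg _)
  have hdisj : ((Finset.range (G.dist u v / 3 + 1) : Finset ℕ) : Set ℕ).PairwiseDisjoint s := by
    intro i hi j hj hij
    rw [Function.onFun, Finset.disjoint_left]
    intro y hyi hyj
    have hi' := hx i (Nat.lt_succ_iff.mp (Finset.mem_range.mp hi))
    have hj' := hx j (Nat.lt_succ_iff.mp (Finset.mem_range.mp hj))
    have h₁ := hconn.dist_of_mem_insert_neighborSet u (Set.mem_toFinset.mp hyi)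
    have h₂ := hconn.dist_of_mem_insert_neighborSet u (Set.mem_toFinset.mp hyj)
    omega
  calc (G.dist u v / 3 + 1) * (d + 1)
      = (Finset.range (G.dist u v / 3 + 1)).card • (d + 1) := by simp
    _ ≤ ∑ i ∈ Finset.range (G.dist u v / 3 + 1), (s i).card :=
        Finset.card_nsmul_le_sum _ _ _ fun i _ ↦ hs i
    _ = ((Finset.range (G.dist u v / 3 + 1)).biUnion s).card := (Finset.card_biUnion hdisj).symm
    _ ≤ Fintype.card V := Finset.card_le_univ _

end SimpleGraph

/-- a connected graph on `n` vertices with minimum degree at least `d ≥ 1`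
satisfies `(diam(G) − 1)·(d + 1) ≤ 3n`. -/
theorem statement14 {V : Type*} [Fintype V] (G : SimpleGraph V) (hconn : G.Connected)
    (d : ℕ) (hd : 1 ≤ d) (hdeg : ∀ u, d ≤ (G.neighborSet u).ncard) :
    (G.diam - 1) * (d + 1) ≤ 3 * Fintype.card V := by
  have := hconn.nonempty
  obtain ⟨u, v, huv⟩ := G.exists_dist_eq_diam
  calc (G.diam - 1) * (d + 1)
      ≤ 3 * (G.dist u v / 3 + 1) * (d + 1) := Nat.mul_le_mul_right _ (by omega)
    _ = 3 * ((G.dist u v / 3 + 1) * (d + 1)) := mul_assoc _ _ _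
    _ ≤ 3 * Fintype.card V := Nat.mul_le_mul_left _ (hconn.mul_succ_le_card hdeg u v)
end
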